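/- For 0 < p ≤ 1/m (with m ≥ 1 an integer), if g is holomorphic on 𝔻 and ∫_𝔻 |g^{(m)}(z)|^p·(1-|z|²)^{mp}·(1-|z|²)^{-2} dA(z) < ∞ with mp ≤ 1, then g^{(m)} ≡ 0, i.e. g is a polynomial of degree at most m-1. -/

import Mathlib

open MeasureTheory
open scoped ENNReal

/-- The normalized Lebesgue (area) measure on `ℂ`, so that the unit disc has measure 1. -/
noncomputable def measA : Measure ℂ := (ENNReal.ofReal Real.pi)⁻¹ • volume

lemma aux_log (h : ℂ → ℂ) (hh : AnalyticOnNhd ℂ h (Metric.ball 0 1)) :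
    ∃ L : ℝ, ∀ r : ℝ, 1/2 ≤ r → r < 1 → L ≤ Real.circleAverage (fun z => Real.log ‖h z‖) 0 r := by
  refine ⟨((meromorphicOrderAt h 0).untop₀ : ℝ) * Real.log (1/2)
    + Real.log ‖meromorphicTrailingCoeffAt h 0‖, fun r hr hr1 => ?_⟩
  have hr0 : 0 < r := by linarith
  have hsub : Metric.closedBall (0:ℂ) |r| ⊆ Metric.ball 0 1 := by
    apply Metric.closedBall_subset_ball; rwa [abs_of_pos hr0]
  have ha := hh.mono hsub
  rw [MeromorphicOn.circleAverage_log_norm hr0.ne' ha.meromorphicOn]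
  have h0 : (0:ℂ) ∈ Metric.closedBall (0:ℂ) |r| := by simp
  have hdiv := MeromorphicOn.divisor_apply ha.meromorphicOn h0
  have hk : (0:ℝ) ≤ ((meromorphicOrderAt h 0).untop₀ : ℝ) := by
    rw [← hdiv]; exact_mod_cast MeromorphicOn.AnalyticOnNhd.divisor_nonneg ha 0
  rw [hdiv]
  have h1 : 0 ≤ ∑ᶠ u, (MeromorphicOn.divisor h (Metric.closedBall (0:ℂ) |r|) u : ℝ)
      * Real.log (r * ‖0 - u‖⁻¹) := by
    apply finsum_nonneg
    intro u
    by_cases hu : u ∈ Metric.closedBall (0:ℂ) |r|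
    · refine mul_nonneg (by exact_mod_cast MeromorphicOn.AnalyticOnNhd.divisor_nonneg ha u) ?_
      by_cases hu0 : u = 0
      · simp [hu0]
      · apply Real.log_nonneg
        have : 0 < ‖u‖ := norm_pos_iff.mpr hu0
        rw [mem_closedBall_zero_iff, abs_of_pos hr0] at hu
        rw [zero_sub, norm_neg, ← div_eq_mul_inv, le_div_iff₀ this]
        linarith
    · simp [hu]
  have h2 : Real.log (1/2) ≤ Real.log r := Real.log_le_log (by norm_num) hr
  have h3 := mul_le_mul_of_nonneg_left h2 hk
  linarith

lemma aux_mean (h : ℂ → ℂ) (hh : AnalyticOnNhd ℂ h (Metric.ball 0 1)) (p : ℝ) (hp : 0 < p)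
    (z₀ : ℂ) (hz₀ : z₀ ∈ Metric.ball (0:ℂ) 1) (hne : h z₀ ≠ 0) :
    ∃ c : ℝ, 0 < c ∧ ∀ r : ℝ, 1/2 ≤ r → r < 1 →
      ENNReal.ofReal c ≤ ∫⁻ θ in Set.Ioo (-Real.pi) Real.pi,
        ENNReal.ofReal (‖h (circleMap 0 r θ)‖ ^ p) := by
  obtain ⟨L, hL⟩ := aux_log h hh
  refine ⟨2 * Real.pi * Real.exp (p * L), by positivity, fun r hr hr1 => ?_⟩
  have hr0 : 0 < r := by linarith
  have hsph : Metric.sphere (0:ℂ) |r| ⊆ Metric.ball 0 1 := by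
    intro z hz
    rw [mem_sphere_zero_iff_norm, abs_of_pos hr0] at hz
    rw [mem_ball_zero_iff]; linarith
  have hcod : h ⁻¹' {0}ᶜ ∈ Filter.codiscreteWithin (Metric.sphere (0:ℂ) |r|) :=
    Filter.codiscreteWithin_mono hsph (hh.preimage_zero_mem_codiscreteWithin hne hz₀
      (Metric.isConnected_ball (by norm_num)))
  have hcod2 := circleMap_preimage_codiscrete hr0.ne' hcod
  have hae : ∀ᵐ θ : ℝ, h (circleMap 0 r θ) ≠ 0 := by
    have := ae_restrict_le_codiscreteWithin (μ := (volume : Measure ℝ)) MeasurableSet.univ hcod2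
    rw [Measure.restrict_univ] at this
    exact this
  have hpi := Real.pi_pos
  -- continuity
  have hcont : Continuous (fun θ : ℝ => ‖h (circleMap 0 r θ)‖ ^ p) := by
    have : Continuous (fun θ : ℝ => h (circleMap 0 r θ)) :=
      hh.continuousOn.comp_continuous (continuous_circleMap 0 r)
        (fun θ => hsph (circleMap_mem_sphere' 0 r θ))
    exact this.norm.rpow_const (fun _ => Or.inr hp.le)
  have hlogint : CircleIntegrable (fun z => Real.log ‖h z‖) 0 r :=
    (hh.mono hsph).meromorphicOn.circleIntegrable_log_norm
  have hkey : 2 * Real.pi * Real.exp (p * L) ≤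
      ∫ θ in (0:ℝ)..(2 * Real.pi), ‖h (circleMap 0 r θ)‖ ^ p := by
    have hmono : ∫ θ in (0:ℝ)..(2 * Real.pi),
        Real.exp (p * L) * (1 + (p * Real.log ‖h (circleMap 0 r θ)‖ - p * L)) ≤
        ∫ θ in (0:ℝ)..(2 * Real.pi), ‖h (circleMap 0 r θ)‖ ^ p := by
      apply intervalIntegral.integral_mono_ae (by positivity)
      · exact (intervalIntegrable_const.add
          ((hlogint.const_mul p).sub intervalIntegrable_const)).const_mul _
      · exact hcont.intervalIntegrable _ _
      · filter_upwards [hae] with θ hθ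
        have hpos : 0 < ‖h (circleMap 0 r θ)‖ := norm_pos_iff.mpr hθ
        have e1 : ‖h (circleMap 0 r θ)‖ ^ p = Real.exp (p * L) *
            Real.exp (p * Real.log ‖h (circleMap 0 r θ)‖ - p * L) := by
          rw [← Real.exp_add, Real.rpow_def_of_pos hpos]; congr 1; ring
        rw [e1]
        apply mul_le_mul_of_nonneg_left _ (Real.exp_pos _).le
        linarith [Real.add_one_le_exp (p * Real.log ‖h (circleMap 0 r θ)‖ - p * L)]
    have hl := hL r hr hr1
    rw [Real.circleAverage_def, smul_eq_mul] at hl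
    have hcomp : ∫ θ in (0:ℝ)..(2 * Real.pi),
        Real.exp (p * L) * (1 + (p * Real.log ‖h (circleMap 0 r θ)‖ - p * L)) =
        Real.exp (p * L) * (2 * Real.pi + (p * (∫ θ in (0:ℝ)..(2 * Real.pi),
          Real.log ‖h (circleMap 0 r θ)‖) - p * L * (2 * Real.pi))) := by
      rw [intervalIntegral.integral_const_mul, intervalIntegral.integral_add
        intervalIntegrable_const ((hlogint.const_mul p).sub intervalIntegrable_const),
        intervalIntegral.integral_sub (hlogint.const_mul p) intervalIntegrable_const,
        intervalIntegral.integral_const_mul]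
      simp
      ring
    rw [hcomp] at hmono
    refine le_trans ?_ hmono
    rw [mul_comm (2 * Real.pi)]
    apply mul_le_mul_of_nonneg_left _ (Real.exp_pos _).le
    have h5 : 2 * Real.pi * L ≤ ∫ θ in (0:ℝ)..(2 * Real.pi), Real.log ‖h (circleMap 0 r θ)‖ := by
      have := mul_le_mul_of_nonneg_left hl (by positivity : 0 ≤ 2 * Real.pi)
      rwa [← mul_assoc, mul_inv_cancel₀ (by positivity), one_mul] at this
    nlinarith [mul_le_mul_of_nonneg_left h5 hp.le]
  have hper : Function.Periodic (fun θ : ℝ => ‖h (circleMap 0 r θ)‖ ^ p) (2 * Real.pi) := by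
    intro θ
    simp only [periodic_circleMap 0 r θ]
  have hshift := hper.intervalIntegral_add_eq 0 (-Real.pi)
  have e2 : (-Real.pi + 2 * Real.pi) = Real.pi := by ring
  rw [zero_add, e2] at hshift
  rw [hshift, intervalIntegral.integral_of_le (by linarith), integral_Ioc_eq_integral_Ioo] at hkey
  rw [← ofReal_integral_eq_lintegral_ofReal]
  · exact ENNReal.ofReal_le_ofReal hkey
  · exact (hcont.integrableOn_Icc).mono_set Set.Ioo_subset_Icc_self
  · exact Filter.Eventually.of_forall fun θ => by positivity

lemma aux_div : ∫⁻ r in Set.Ioo (1/2 : ℝ) 1, ENNReal.ofReal ((1 - r)⁻¹) = ⊤ := by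
  by_contra hne
  have hint : IntegrableOn (fun r : ℝ => (1 - r)⁻¹) (Set.Ioo (1/2 : ℝ) 1) := by
    refine ⟨by measurability, ?_⟩
    rw [hasFiniteIntegral_iff_ofReal]
    · exact lt_top_iff_ne_top.mpr hne
    · filter_upwards [ae_restrict_mem measurableSet_Ioo] with r hr
      have : 0 < 1 - r := by linarith [hr.2]
      simp only [Pi.zero_apply]
      positivity
  have h2 : IntervalIntegrable (fun r : ℝ => (r - 1)⁻¹) volume (1/2) 1 := by
    rw [intervalIntegrable_iff_integrableOn_Ioo_of_le (by norm_num)]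
    refine hint.neg.congr_fun (fun r _ => ?_) measurableSet_Ioo
    simp only [Pi.neg_apply]
    rw [← inv_neg, neg_sub]
  rw [intervalIntegrable_sub_inv_iff] at h2
  rcases h2 with h2 | h2
  · norm_num at h2
  · exact h2 Set.right_mem_uIcc

theorem besov_degeneracy (m : ℕ) (hm : 1 ≤ m) (p : ℝ) (hp : 0 < p)
    (hpm : p ≤ 1 / (m : ℝ)) (g : ℂ → ℂ)
    (hg : DifferentiableOn ℂ g {z : ℂ | ‖z‖ < 1})
    (hint : (∫⁻ z in {z : ℂ | ‖z‖ < 1},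
        ENNReal.ofReal (‖iteratedDeriv m g z‖ ^ p *
          (1 - ‖z‖ ^ 2) ^ ((m : ℝ) * p - 2)) ∂measA) < ⊤) :
    ∀ z : ℂ, ‖z‖ < 1 → iteratedDeriv m g z = 0 := by
  have hball : {z : ℂ | ‖z‖ < 1} = Metric.ball 0 1 := by ext z; simp
  rw [hball] at hg hint
  have hh : AnalyticOnNhd ℂ (iteratedDeriv m g) (Metric.ball 0 1) := by
    have h0 := hg.analyticOnNhd Metric.isOpen_ball
    clear hint hm hpm
    induction m with
    | zero => simpa using h0
    | succ n ih => rw [iteratedDeriv_succ]; exact AnalyticOnNhd.deriv ih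
  by_contra hcon
  push Not at hcon
  obtain ⟨z₀, hz₀, hne⟩ := hcon
  generalize iteratedDeriv m g = h at hh hint hne
  obtain ⟨c, hc, hmean⟩ := aux_mean h hh p hp z₀ (by simpa using hz₀) hne
  have hmp : (m : ℝ) * p - 2 ≤ -1 := by
    have hm0 : (0:ℝ) < m := by exact_mod_cast hm
    rw [le_div_iff₀ hm0] at hpm
    linarith
  set s : ℝ := (m : ℝ) * p - 2
  -- pass to Lebesgue measure
  rw [measA, Measure.restrict_smul, lintegral_smul_measure, smul_eq_mul] at hint
  have hvol : (∫⁻ z in Metric.ball (0:ℂ) 1,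
      ENNReal.ofReal (‖h z‖ ^ p * (1 - ‖z‖ ^ 2) ^ s)) ≠ ⊤ := by
    intro htop
    rw [htop, ENNReal.mul_top] at hint
    · exact lt_irrefl _ hint
    · simp
  apply hvol
  rw [← lintegral_indicator Metric.isOpen_ball.measurableSet]
  set F : ℂ → ℝ≥0∞ := (Metric.ball (0:ℂ) 1).indicator
    (fun z => ENNReal.ofReal (‖h z‖ ^ p * (1 - ‖z‖ ^ 2) ^ s)) with hF
  have hFm : Measurable F := by
    have hco : ContinuousOn (fun z : ℂ => ENNReal.ofReal (‖h z‖ ^ p * (1 - ‖z‖ ^ 2) ^ s))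
        (Metric.ball (0:ℂ) 1) := by
      apply ENNReal.continuous_ofReal.comp_continuousOn
      apply ContinuousOn.mul
      · exact hh.continuousOn.norm.rpow_const (fun _ _ => Or.inr hp.le)
      · apply ContinuousOn.rpow_const
        · fun_prop
        · intro z hz
          left
          rw [mem_ball_zero_iff] at hz
          nlinarith [norm_nonneg z]
    classical
    rw [hF, ← Set.piecewise_eq_indicator]
    exact hco.measurable_piecewise continuousOn_const Metric.isOpen_ball.measurableSet
  have hsymm : ∀ q : ℝ × ℝ, Complex.polarCoord.symm q = circleMap 0 q.1 q.2 := by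
    intro q
    rw [Complex.polarCoord_symm_apply, circleMap_zero, Complex.exp_mul_I,
      Complex.ofReal_cos, Complex.ofReal_sin]
  rw [← Complex.lintegral_comp_polarCoord_symm, polarCoord_target]
  simp only [hsymm, smul_eq_mul]
  rw [Measure.volume_eq_prod, ← Measure.prod_restrict, lintegral_prod]
  swap
  · apply Measurable.aemeasurable
    have := hFm.comp (Real.circleMap.continuous (c := 0)).measurable
    exact (ENNReal.measurable_ofReal.comp measurable_fst).mul this
  rw [eq_top_iff]
  calc (⊤ : ℝ≥0∞) = ENNReal.ofReal (c / 4) *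
        ∫⁻ r in Set.Ioo (1/2 : ℝ) 1, ENNReal.ofReal ((1 - r)⁻¹) := by
        rw [aux_div, ENNReal.mul_top]
        simpa using hc
    _ = ∫⁻ r in Set.Ioo (1/2 : ℝ) 1, ENNReal.ofReal (c / 4) * ENNReal.ofReal ((1 - r)⁻¹) := by
        rw [lintegral_const_mul' _ _ ENNReal.ofReal_ne_top]
    _ ≤ ∫⁻ r in Set.Ioo (1/2 : ℝ) 1, ∫⁻ θ in Set.Ioo (-Real.pi) Real.pi,
          ENNReal.ofReal r * F (circleMap 0 r θ) := by
        apply setLIntegral_mono' measurableSet_Ioo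
        intro r hr
        have hr0 : 0 < r := by linarith [hr.1]
        have hr1 := hr.2
        have hq : 0 < 1 - r := by linarith
        have hFe : ∀ θ : ℝ, ENNReal.ofReal r * F (circleMap 0 r θ) =
            ENNReal.ofReal (r * (1 - r ^ 2) ^ s) * ENNReal.ofReal (‖h (circleMap 0 r θ)‖ ^ p) := by
          intro θ
          have hn : ‖circleMap 0 r θ‖ = r := by simp [abs_of_pos hr0]
          have hmem : circleMap 0 r θ ∈ Metric.ball (0:ℂ) 1 := by
            rw [mem_ball_zero_iff, hn]; exact hr1
          rw [hF, Set.indicator_of_mem hmem, hn, ← ENNReal.ofReal_mul hr0.le,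
            ← ENNReal.ofReal_mul]
          · congr 1; ring
          · apply mul_nonneg hr0.le
            apply Real.rpow_nonneg
            nlinarith
        simp only [hFe]
        rw [lintegral_const_mul' _ _ ENNReal.ofReal_ne_top]
        refine le_trans ?_ (mul_le_mul_right (hmean r hr.1.le hr1) _)
        rw [← ENNReal.ofReal_mul (by positivity), ← ENNReal.ofReal_mul]
        swap
        · apply mul_nonneg hr0.le
          apply Real.rpow_nonneg
          nlinarith
        apply ENNReal.ofReal_le_ofReal
        have hq2 : 0 < 1 - r ^ 2 := by nlinarith
        have hb : (1 - r ^ 2)⁻¹ ≤ (1 - r ^ 2) ^ s := by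
          rw [← Real.rpow_neg_one]
          exact Real.rpow_le_rpow_of_exponent_ge hq2 (by nlinarith) hmp
        have hb2 : (1 - r)⁻¹ / 2 ≤ (1 - r ^ 2)⁻¹ := by
          rw [div_eq_mul_inv, ← mul_inv]
          apply inv_anti₀ hq2
          nlinarith
        have hb3 : (1/2) * ((1 - r)⁻¹ / 2) ≤ r * (1 - r ^ 2) ^ s :=
          mul_le_mul hr.1.le (hb2.trans hb) (by positivity) hr0.le
        nlinarith [mul_le_mul_of_nonneg_left hb3 hc.le]
    _ ≤ _ := by
        apply lintegral_mono_set
        intro r hr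
        have := hr.1
        simp only [Set.mem_Ioi]
        linarith
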